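/- For every augmented user program P there exists a disjunctive program P' such that P' is a strong conservative extension of P. -/

import Mathlib

namespace ASP

/-- Propositional formulas over atoms `α`, built with ∧, ∨, ← and ⊥.
`impl A B` denotes the formula `B ← A` (i.e. `A → B`). -/
inductive PropForm (α : Type) : Type
  | var : α → PropForm α
  | fals : PropForm α
  | conj : PropForm α → PropForm α → PropForm α
  | disj : PropForm α → PropForm α → PropForm α
  | impl : PropForm α → PropForm α → PropForm α
  deriving DecidableEq

namespace PropForm

variable {α : Type}

/-- `¬F` abbreviates `⊥ ← F`. -/
def neg (A : PropForm α) : PropForm α := impl A fals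

/-- `⊤` abbreviates `⊥ ← ⊥`. -/
def top : PropForm α := impl fals fals

/-- The set of atoms occurring in a formula. -/
def atoms : PropForm α → Set α
  | var a => {a}
  | fals => ∅
  | conj A B => atoms A ∪ atoms B
  | disj A B => atoms A ∪ atoms B
  | impl A B => atoms A ∪ atoms B

end PropForm

open PropForm

/-- Hilbert-style derivability for intuitionistic propositional logic,
with an extra set `Ax` of additional axioms. -/
inductive Deriv {α : Type} (Ax : Set (PropForm α)) : PropForm α → Prop
  | ax {A} : A ∈ Ax → Deriv Ax A
  | k (A B) : Deriv Ax (impl A (impl B A))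
  | s (A B C) : Deriv Ax (impl (impl A (impl B C)) (impl (impl A B) (impl A C)))
  | conjIntro (A B) : Deriv Ax (impl A (impl B (conj A B)))
  | conjElimL (A B) : Deriv Ax (impl (conj A B) A)
  | conjElimR (A B) : Deriv Ax (impl (conj A B) B)
  | disjIntroL (A B) : Deriv Ax (impl A (disj A B))
  | disjIntroR (A B) : Deriv Ax (impl B (disj A B))
  | disjElim (A B C) : Deriv Ax (impl (impl A C) (impl (impl B C) (impl (disj A B) C)))
  | falsElim (A) : Deriv Ax (impl fals A)
  | mp {A B} : Deriv Ax (impl A B) → Deriv Ax A → Deriv Ax B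

/-- `F` is a theorem of intuitionistic propositional logic. -/
def IThm {α : Type} (F : PropForm α) : Prop := Deriv ∅ F

/-- `F` is a theorem of classical propositional logic
(intuitionistic logic plus double-negation elimination). -/
def CThm {α : Type} (F : PropForm α) : Prop :=
  Deriv {F | ∃ A, F = impl (neg (neg A)) A} F

/-- Conjunction of a finite list of formulas (empty conjunction is ⊤). -/
def bigConj {α : Type} : List (PropForm α) → PropForm α
  | [] => top
  | [A] => A
  | A :: L => conj A (bigConj L)

/-- Disjunction of a finite list of formulas (empty disjunction is ⊥). -/
def bigDisj {α : Type} : List (PropForm α) → PropForm α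
  | [] => fals
  | [A] => A
  | A :: L => disj A (bigDisj L)

/-- `T ⊢_X F`: the formula `F ← (F₁ ∧ ... ∧ Fₙ)` is a theorem of the logic
whose theorems are `Thm`, for some `F₁, ..., Fₙ ∈ T`. -/
def ProvesFrom {α : Type} (Thm : PropForm α → Prop) (T : Set (PropForm α))
    (F : PropForm α) : Prop :=
  ∃ L : List (PropForm α), (∀ G ∈ L, G ∈ T) ∧ Thm (impl (bigConj L) F)

/-- `T ⊢_I F`. -/
def IProves {α : Type} (T : Set (PropForm α)) (F : PropForm α) : Prop :=
  ProvesFrom IThm T F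

/-- `T ⊢_C F`. -/
def CProves {α : Type} (T : Set (PropForm α)) (F : PropForm α) : Prop :=
  ProvesFrom CThm T F

/-- `T` is consistent in intuitionistic logic. -/
def IConsistent {α : Type} (T : Set (PropForm α)) : Prop := ¬ IProves T fals

/-- `T ⊩_I M`: `T` is consistent and proves (intuitionistically) every atom of `M`. -/
def IProvesAll {α : Type} (T : Set (PropForm α)) (M : Set α) : Prop :=
  IConsistent T ∧ ∀ a ∈ M, IProves T (var a)

/-- `T ≡_I U`: the two theories prove each other's formulas intuitionistically. -/
def IEquivTh {α : Type} (T U : Set (PropForm α)) : Prop :=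
  (∀ F ∈ U, IProves T F) ∧ (∀ F ∈ T, IProves U F)

/-- The signature (set of occurring atoms) of a theory. -/
def sigTh {α : Type} (T : Set (PropForm α)) : Set α := ⋃ F ∈ T, F.atoms

/-- `T` is (literal) complete: for every atom `a` of its signature,
`T ⊢_I a` or `T ⊢_I ¬a`. -/
def IComplete {α : Type} (T : Set (PropForm α)) : Prop :=
  ∀ a ∈ sigTh T, IProves T (var a) ∨ IProves T (neg (var a))

/-- `{¬a : a ∈ S}`. -/
def negSet {α : Type} (S : Set α) : Set (PropForm α) := (fun a => neg (var a)) '' S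

/-- `{¬¬a : a ∈ S}`. -/
def negnegSet {α : Type} (S : Set α) : Set (PropForm α) :=
  (fun a => neg (neg (var a))) '' S

/-- Classical two-valued satisfaction, identifying an interpretation with the
set of atoms it makes true. -/
def sat2 {α : Type} (X : Set α) : PropForm α → Prop
  | .var a => a ∈ X
  | .fals => False
  | .conj A B => sat2 X A ∧ sat2 X B
  | .disj A B => sat2 X A ∨ sat2 X B
  | .impl A B => sat2 X A → sat2 X B

/-- `X` is a classical model of the theory `T`. -/
def isModel2 {α : Type} (X : Set α) (T : Set (PropForm α)) : Prop := ∀ F ∈ T, sat2 X F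

/-- `M` is a minimal (under ⊆) classical model of `T`. -/
def isMinModel {α : Type} (T : Set (PropForm α)) (M : Set α) : Prop :=
  isModel2 M T ∧ ∀ N ⊆ M, isModel2 N T → N = M

/-- Evaluation in the 3-valued Gödel logic G3. -/
def g3 {α : Type} (I : α → Fin 3) : PropForm α → Fin 3
  | .var a => I a
  | .fals => 0
  | .conj A B => min (g3 I A) (g3 I B)
  | .disj A B => max (g3 I A) (g3 I B)
  | .impl A B => if g3 I A ≤ g3 I B then 2 else g3 I B

/-- Nested formulas: built from atoms, ⊤ and ⊥ using ∧, ∨ and ¬. -/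
inductive NF (α : Type) : Type
  | var : α → NF α
  | top : NF α
  | bot : NF α
  | conj : NF α → NF α → NF α
  | disj : NF α → NF α → NF α
  | neg : NF α → NF α
  deriving DecidableEq

namespace NF

variable {α : Type}

/-- Reading a nested formula as a propositional formula
(`⊤ = ⊥ ← ⊥` and `¬F = ⊥ ← F`). -/
def toProp : NF α → PropForm α
  | var a => .var a
  | top => PropForm.top
  | bot => .fals
  | conj A B => .conj (toProp A) (toProp B)
  | disj A B => .disj (toProp A) (toProp B)
  | neg A => PropForm.neg (toProp A)

/-- Atoms occurring in a nested formula. -/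
def atoms : NF α → Set α
  | var a => {a}
  | top => ∅
  | bot => ∅
  | conj A B => atoms A ∪ atoms B
  | disj A B => atoms A ∪ atoms B
  | neg A => atoms A

/-- Satisfaction of a (basic, negation-free) nested formula by a set of atoms. -/
def satB (X : Set α) : NF α → Prop
  | var a => a ∈ X
  | top => True
  | bot => False
  | conj A B => satB X A ∧ satB X B
  | disj A B => satB X A ∨ satB X B
  | neg A => ¬ satB X A

open scoped Classical in
/-- The reduct `F^X`: each maximal subformula `¬G` is replaced by ⊥ if
`X ⊨ G^X` and by ⊤ otherwise. -/
noncomputable def reduct (X : Set α) : NF α → NF α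
  | var a => var a
  | top => top
  | bot => bot
  | conj A B => conj (reduct X A) (reduct X B)
  | disj A B => disj (reduct X A) (reduct X B)
  | neg A => if satB X (reduct X A) then bot else top

end NF

/-- An augmented clause `H ← B` is a pair `(H, B)` of nested formulas. -/
abbrev AugClause (α : Type) := NF α × NF α

/-- The propositional formula `H ← B` of an augmented clause. -/
def clauseToProp {α : Type} (c : AugClause α) : PropForm α :=
  .impl c.2.toProp c.1.toProp

/-- The theory of an augmented program. -/
def progTh {α : Type} (P : List (AugClause α)) : Set (PropForm α) :=
  {F | ∃ c ∈ P, clauseToProp c = F}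

/-- The signature of an augmented program. -/
def progSig {α : Type} (P : List (AugClause α)) : Set α :=
  {a | ∃ c ∈ P, a ∈ c.1.atoms ∪ c.2.atoms}

/-- `X` is closed under the (basic) program `P`: for each clause `H ← B`,
`X ⊨ H` whenever `X ⊨ B`. -/
def closedUnder {α : Type} (X : Set α) (P : List (AugClause α)) : Prop :=
  ∀ c ∈ P, NF.satB X c.2 → NF.satB X c.1

/-- The reduct `P^X` of an augmented program. -/
noncomputable def progReduct {α : Type} (X : Set α) (P : List (AugClause α)) :
    List (AugClause α) :=
  P.map fun c => (c.1.reduct X, c.2.reduct X)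

/-- `M` is an answer set of `P`: `M` is minimal (under ⊆) among the sets of
atoms closed under the reduct `P^M`. -/
def isAnswerSet {α : Type} (P : List (AugClause α)) (M : Set α) : Prop :=
  closedUnder M (progReduct M P) ∧ ∀ N ⊆ M, closedUnder N (progReduct M P) → N = M

/-- `M` is a min-answer set of `P`: both an answer set and a minimal model. -/
def isMinAnswerSet {α : Type} (P : List (AugClause α)) (M : Set α) : Prop :=
  isAnswerSet P M ∧ isMinModel (progTh P) M

/-- A G3 interpretation models an augmented program. -/
def g3ModelsProg {α : Type} (I : α → Fin 3) (P : List (AugClause α)) : Prop :=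
  ∀ c ∈ P, g3 I (clauseToProp c) = 2

/-- A free clause: a list of head literals and a list of body literals,
a literal being an atom `(a, true)` or a negated atom `(a, false)`.
It denotes `h₁ ∨ ... ∨ hₙ ← b₁ ∧ ... ∧ bₘ` (empty head = ⊥, empty body = ⊤). -/
structure FClause (α : Type) where
  head : List (α × Bool)
  body : List (α × Bool)
  deriving DecidableEq

/-- The propositional formula of a literal. -/
def litToProp {α : Type} : α × Bool → PropForm α
  | (a, true) => .var a
  | (a, false) => PropForm.neg (.var a)

/-- The nested formula of a literal. -/
def litToNF {α : Type} : α × Bool → NF α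
  | (a, true) => .var a
  | (a, false) => .neg (.var a)

/-- Disjunction of a list of nested formulas (empty = ⊥). -/
def bigDisjNF {α : Type} : List (NF α) → NF α
  | [] => .bot
  | [A] => A
  | A :: L => .disj A (bigDisjNF L)

/-- Conjunction of a list of nested formulas (empty = ⊤). -/
def bigConjNF {α : Type} : List (NF α) → NF α
  | [] => .top
  | [A] => A
  | A :: L => .conj A (bigConjNF L)

namespace FClause

variable {α : Type}

/-- The propositional formula of a free clause. -/
def toProp (c : FClause α) : PropForm α :=
  .impl (bigConj (c.body.map litToProp)) (bigDisj (c.head.map litToProp))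

/-- A free clause as an augmented clause. -/
def toAug (c : FClause α) : AugClause α :=
  (bigDisjNF (c.head.map litToNF), bigConjNF (c.body.map litToNF))

/-- The atoms of a free clause. -/
def atomsF (c : FClause α) : Set α :=
  {a | (∃ b, (a, b) ∈ c.head) ∨ (∃ b, (a, b) ∈ c.body)}

/-- A general clause: all head literals are positive atoms. -/
def isGeneral (c : FClause α) : Prop := ∀ l ∈ c.head, l.2 = true

/-- A disjunctive clause: a general clause with nonempty head. -/
def isDisjunctive (c : FClause α) : Prop := c.isGeneral ∧ c.head ≠ []

/-- A constraint: a clause with empty head (head ⊥). -/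
def isConstraint (c : FClause α) : Prop := c.head = []

end FClause

/-- The theory of a free program. -/
def fTh {α : Type} (P : List (FClause α)) : Set (PropForm α) :=
  {F | ∃ c ∈ P, c.toProp = F}

/-- The signature of a free program. -/
def fSig {α : Type} (P : List (FClause α)) : Set α :=
  {a | ∃ c ∈ P, a ∈ c.atomsF}

/-- `GenDisj(P)`: each constraint `⊥ ← B` is replaced by `p ← B ∧ ¬p`,
where `p` is a new reserved atom. -/
def genDisj {α : Type} [DecidableEq α] (P : List (FClause α)) (p : α) :
    List (FClause α) :=
  P.map fun c =>
    if c.head = [] then ⟨[(p, true)], c.body ++ [(p, false)]⟩ else c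

/-- The atoms `a` such that `¬a` occurs in the head of some clause of `P`
(the set `S` of the FreeGen transformation), as a list. -/
def headNegs {α : Type} (P : List (FClause α)) : List α :=
  P.flatMap fun c => c.head.filterMap fun l => if l.2 = false then some l.1 else none

open scoped Classical in
/-- Replace the occurrence of `¬a` (for `a ∈ S`) by the positive atom `φ a`. -/
noncomputable def substLit {α : Type} (S : Set α) (φ : α → α) (l : α × Bool) :
    α × Bool :=
  if l.2 = false ∧ l.1 ∈ S then (φ l.1, true) else l

/-- Replace every occurrence of `¬a` (for `a ∈ S`) by `φ a` in a clause. -/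
noncomputable def FClause.subst {α : Type} (S : Set α) (φ : α → α) (c : FClause α) :
    FClause α :=
  ⟨c.head.map (substLit S φ), c.body.map (substLit S φ)⟩

/-- `Δ_S = ⋃_{a ∈ S} {φ(a) ← ¬a, ⊥ ← a ∧ φ(a)}`. -/
def deltaClauses {α : Type} (L : List α) (φ : α → α) : List (FClause α) :=
  L.flatMap fun a => [⟨[(φ a, true)], [(a, false)]⟩, ⟨[], [(a, true), (φ a, true)]⟩]

/-- `FreeGen(P) = P' ∪ Δ_S`. -/
noncomputable def freeGen {α : Type} (P : List (FClause α)) (φ : α → α) :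
    List (FClause α) :=
  P.map (FClause.subst {a | a ∈ headNegs P} φ) ++ deltaClauses (headNegs P) φ

open scoped Classical in
/-- The second reduction `redu2(P; ¬¬M)`: clauses whose body contains a literal
`¬a` with `a ∈ M` are deleted; in constraints, positive body literals `a ∈ M`
are deleted. -/
noncomputable def redu2 {α : Type} [DecidableEq α] (P : List (FClause α))
    (M : Set α) : List (FClause α) :=
  (P.filter fun c => decide (¬ ∃ l ∈ c.body, l.2 = false ∧ l.1 ∈ M)).map
    fun c =>
      if c.head = [] then
        ⟨[], c.body.filter fun l => decide (¬ (l.2 = true ∧ l.1 ∈ M))⟩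
      else c

/-- `P₂` is a conservative extension of `P₁`: `M₁` is an answer set of `P₁`
iff `M₂` is an answer set of `P₂`, where `M₁ = M₂ ∩ σ_{P₁}`. -/
def consExt {α : Type} (P1 P2 : List (AugClause α)) : Prop :=
  (∀ M2 : Set α, isAnswerSet P2 M2 → isAnswerSet P1 (M2 ∩ progSig P1)) ∧
  (∀ M1 : Set α, isAnswerSet P1 M1 →
    ∃ M2 : Set α, isAnswerSet P2 M2 ∧ M1 = M2 ∩ progSig P1)

/-- `P₂` is a strong conservative extension of the user program `P₁` (relative
to the user signature `U`): for every user program `P`, `P₂ ∪ P` is a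
conservative extension of `P₁ ∪ P`. -/
def strongConsExt {α : Type} (P1 P2 : List (AugClause α)) (U : Set α) : Prop :=
  ∀ P : List (AugClause α), progSig P ⊆ U → consExt (P1 ++ P) (P2 ++ P)

mutual
  /-- Negation normal form: push negations inward (no pending negation). -/
  def nnf0 {α : Type} : NF α → NF α
    | .var a => .var a
    | .top => .top
    | .bot => .bot
    | .conj A B => .conj (nnf0 A) (nnf0 B)
    | .disj A B => .disj (nnf0 A) (nnf0 B)
    | .neg A => nnf1 A
  /-- Negation normal form under one pending negation. -/
  def nnf1 {α : Type} : NF α → NF α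
    | .var a => .neg (.var a)
    | .top => .bot
    | .bot => .top
    | .conj A B => .disj (nnf1 A) (nnf1 B)
    | .disj A B => .conj (nnf1 A) (nnf1 B)
    | .neg A => nnf2 A
  /-- Negation normal form under two pending negations. -/
  def nnf2 {α : Type} : NF α → NF α
    | .var a => .neg (.neg (.var a))
    | .top => .top
    | .bot => .bot
    | .conj A B => .conj (nnf2 A) (nnf2 B)
    | .disj A B => .disj (nnf2 A) (nnf2 B)
    | .neg A => nnf1 A
end

/-- Conjunctive normal form (list of disjunction-lists of leaves). -/
def cnfNF {α : Type} : NF α → List (List (NF α))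
  | .conj A B => cnfNF A ++ cnfNF B
  | .disj A B => (cnfNF A).flatMap fun c => (cnfNF B).map fun d => c ++ d
  | F => [[F]]

/-- Disjunctive normal form (list of conjunction-lists of leaves). -/
def dnfNF {α : Type} : NF α → List (List (NF α))
  | .disj A B => dnfNF A ++ dnfNF B
  | .conj A B => (dnfNF A).flatMap fun c => (dnfNF B).map fun d => c ++ d
  | F => [[F]]

/-- Read a leaf as a literal (if it is one). -/
def leafLit {α : Type} : NF α → Option (α × Bool)
  | .var a => some (a, true)
  | .neg (.var a) => some (a, false)
  | _ => none

/-- Read a leaf `¬¬a` as the literal `¬a` to be moved to the other side. -/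
def dnegLit {α : Type} : NF α → Option (α × Bool)
  | .neg (.neg (.var a)) => some (a, false)
  | _ => none

/-- Build a free clause from a head disjunct-list and a body conjunct-list:
doubly negated atoms `¬¬a` in the head become `¬a` in the body and vice versa;
trivial clauses (⊤ in the head or ⊥ in the body) are removed. -/
def procClause {α : Type} [DecidableEq α] (hd bd : List (NF α)) :
    Option (FClause α) :=
  if NF.top ∈ hd ∨ NF.bot ∈ bd then none
  else some ⟨hd.filterMap leafLit ++ bd.filterMap dnegLit,
             bd.filterMap leafLit ++ hd.filterMap dnegLit⟩

/-- `AugFree(P)`: the free program obtained from the augmented program `P` by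
pushing negations inward, taking CNF of heads and DNF of bodies, splitting
conjunctions in heads and disjunctions in bodies into separate clauses, and
eliminating doubly negated atoms. -/
def augFree {α : Type} [DecidableEq α] (P : List (AugClause α)) :
    List (FClause α) :=
  P.flatMap fun c =>
    (cnfNF (nnf0 c.1)).flatMap fun hd =>
      (dnfNF (nnf0 c.2)).filterMap fun bd => procClause hd bd

/-- Positive formulas: no negation (in particular no ⊥) occurs. -/
def IsPositive {α : Type} : PropForm α → Prop
  | .var _ => True
  | .fals => False
  | .conj A B => IsPositive A ∧ IsPositive B
  | .disj A B => IsPositive A ∧ IsPositive B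
  | .impl A B => IsPositive A ∧ IsPositive B

/-- The set 𝐍 of two-negated formulas. -/
inductive IsTwoNeg {α : Type} : PropForm α → Prop
  | atom (a : α) : IsTwoNeg (neg (neg (var a)))
  | dneg {A} : IsTwoNeg A → IsTwoNeg (neg (neg A))
  | conj {A B} : IsTwoNeg A → IsTwoNeg B → IsTwoNeg (PropForm.conj A B)
  | disjL {A} (B) : IsTwoNeg A → IsTwoNeg (PropForm.disj A B)
  | disjR {A} (B) : IsTwoNeg A → IsTwoNeg (PropForm.disj B A)
  | himp {A} (B) : IsTwoNeg A → IsTwoNeg (PropForm.impl B A)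

theorem exists_mem_listMap {β γ : Type} {f : β → γ} {L : List β} {p : γ → Prop} :
    (∃ x ∈ L.map f, p x) ↔ ∃ a ∈ L, p (f a) := by
  simp only [List.mem_map, exists_exists_and_eq_and]

/-- Satisfaction of a literal at the pair `(N, M)`: atoms are read in `N`,
negated atoms in `M`. -/
def litHolds {α : Type} (N M : Set α) : α × Bool → Prop
  | (a, true) => a ∈ N
  | (a, false) => a ∉ M

theorem satB_reduct_litToNF {α : Type} (N M : Set α) (l : α × Bool) :
    ((litToNF l).reduct M).satB N ↔ litHolds N M l := by
  rcases l with ⟨a, _ | _⟩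
  · by_cases h : a ∈ M <;> simp [litToNF, litHolds, NF.reduct, NF.satB, h]
  · simp [litToNF, litHolds, NF.reduct, NF.satB]

theorem satB_reduct_bigDisjNF {α : Type} (N M : Set α) (L : List (NF α)) :
    ((bigDisjNF L).reduct M).satB N ↔ ∃ F ∈ L, (F.reduct M).satB N := by
  induction L with
  | nil => simp [bigDisjNF, NF.reduct, NF.satB]
  | cons A L ih =>
    cases L with
    | nil => simp [bigDisjNF]
    | cons B L =>
      rw [bigDisjNF.eq_3 _ _ (List.cons_ne_nil _ _), NF.reduct, NF.satB, ih,
        List.exists_mem_cons_iff (a := A)]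

theorem satB_reduct_bigConjNF {α : Type} (N M : Set α) (L : List (NF α)) :
    ((bigConjNF L).reduct M).satB N ↔ ∀ F ∈ L, (F.reduct M).satB N := by
  induction L with
  | nil => simp [bigConjNF, NF.reduct, NF.satB]
  | cons A L ih =>
    cases L with
    | nil => simp [bigConjNF]
    | cons B L =>
      rw [bigConjNF.eq_3 _ _ (List.cons_ne_nil _ _), NF.reduct, NF.satB, ih,
        List.forall_mem_cons (a := A)]

theorem closedUnder_progReduct {α : Type} (N M : Set α) (P : List (AugClause α)) :
    closedUnder N (progReduct M P) ↔
      ∀ c ∈ P, (c.2.reduct M).satB N → (c.1.reduct M).satB N := by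
  exact List.forall_mem_map

theorem closedUnder_progReduct_append {α : Type} (N M : Set α)
    (P Q : List (AugClause α)) :
    closedUnder N (progReduct M (P ++ Q)) ↔
      closedUnder N (progReduct M P) ∧ closedUnder N (progReduct M Q) := by
  simp only [closedUnder_progReduct, List.mem_append, or_imp, forall_and]

theorem closedUnder_progReduct_toAug {α : Type} (N M : Set α) (P : List (FClause α)) :
    closedUnder N (progReduct M (P.map FClause.toAug)) ↔
      ∀ c ∈ P, (∀ l ∈ c.body, litHolds N M l) → ∃ l ∈ c.head, litHolds N M l := by
  simp only [closedUnder_progReduct, FClause.toAug, satB_reduct_bigConjNF,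
    satB_reduct_bigDisjNF, List.forall_mem_map, exists_mem_listMap, satB_reduct_litToNF]

/-- Satisfaction of the reduct depends only on the atoms that occur in the formula. -/
theorem satB_reduct_congr {α : Type} {S M M' : Set α} (hM : ∀ a ∈ S, a ∈ M ↔ a ∈ M')
    (F : NF α) (hF : F.atoms ⊆ S) {N N' : Set α} (hN : ∀ a ∈ S, a ∈ N ↔ a ∈ N') :
    (F.reduct M).satB N ↔ (F.reduct M').satB N' := by
  induction F generalizing N N' with
  | var a => exact hN a (hF rfl)
  | top => rfl
  | bot => rfl
  | conj A B ihA ihB =>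
    exact and_congr (ihA (fun _ h => hF (Or.inl h)) hN) (ihB (fun _ h => hF (Or.inr h)) hN)
  | disj A B ihA ihB =>
    exact or_congr (ihA (fun _ h => hF (Or.inl h)) hN) (ihB (fun _ h => hF (Or.inr h)) hN)
  | neg A ih =>
    have h := ih hF hM
    by_cases hA : (A.reduct M).satB M
    · simp [NF.reduct, NF.satB, hA, h.1 hA]
    · simp [NF.reduct, NF.satB, hA, mt h.2 hA]

theorem closedUnder_progReduct_congr {α : Type} {S M M' N N' : Set α}
    {P : List (AugClause α)} (hP : progSig P ⊆ S) (hM : ∀ a ∈ S, a ∈ M ↔ a ∈ M')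
    (hN : ∀ a ∈ S, a ∈ N ↔ a ∈ N') :
    closedUnder N (progReduct M P) ↔ closedUnder N' (progReduct M' P) := by
  simp only [closedUnder_progReduct]
  refine forall₂_congr fun c hc => imp_congr ?_ ?_
  · exact satB_reduct_congr hM _ (fun a h => hP ⟨c, hc, Or.inr h⟩) hN
  · exact satB_reduct_congr hM _ (fun a h => hP ⟨c, hc, Or.inl h⟩) hN

theorem NF.finite_atoms {α : Type} (F : NF α) : F.atoms.Finite := by
  induction F with
  | var a => exact Set.finite_singleton a
  | top => exact Set.finite_empty
  | bot => exact Set.finite_empty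
  | conj A B ihA ihB => exact ihA.union ihB
  | disj A B ihA ihB => exact ihA.union ihB
  | neg A ih => exact ih

theorem finite_progSig {α : Type} (P : List (AugClause α)) : (progSig P).Finite := by
  have h : progSig P = ⋃ c ∈ {c | c ∈ P}, (c.1.atoms ∪ c.2.atoms) := by
    ext a; simp [progSig]
  rw [h]
  exact (List.finite_toSet P).biUnion fun c _ => c.1.finite_atoms.union c.2.finite_atoms

theorem progSig_append {α : Type} (P Q : List (AugClause α)) :
    progSig (P ++ Q) = progSig P ∪ progSig Q := by
  ext a
  simp only [progSig, List.mem_append, Set.mem_ofPred_eq, Set.mem_union, or_and_right, exists_or]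

theorem isAnswerSet.subset_progSig {α : Type} {P : List (AugClause α)} {M : Set α}
    (h : isAnswerSet P M) : M ⊆ progSig P := by
  have := h.2 (M ∩ progSig P) Set.inter_subset_left
    ((closedUnder_progReduct_congr le_rfl (fun _ _ => Iff.rfl)
      (fun a ha => by simp [ha])).1 h.1)
  exact Set.inter_eq_left.1 this

/-- The clause that excludes the pair `(X, Y)` of sets of atoms over `A`; here `p` is
underivable and `φ a` stands for `¬a`. -/
noncomputable def excludeClause {α : Type} [DecidableEq α] (A : Finset α) (φ : α → α) (p : α)
    (X Y : Finset α) : FClause α where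
  head := (p, true) :: (Y \ X).toList.map fun a => (a, true)
  body := (p, false) :: (X.toList.map (fun a => (a, true)) ++
    ((A \ Y).toList.map (fun a => (a, false)) ++ Y.toList.map fun a => (φ a, false)))

open scoped Classical in
/-- The clauses `φ a ← ¬a` for `a ∈ A`, together with the clauses excluding every pair
of subsets of `A` that does not satisfy `P`. -/
noncomputable def disjunctiveTranslation {α : Type} [DecidableEq α] (P : List (AugClause α))
    (A : Finset α) (φ : α → α) (p : α) : List (FClause α) :=
  A.toList.map (fun a => ⟨[(φ a, true)], [(a, false)]⟩) ++
    ((A.powerset ×ˢ A.powerset).filter fun q =>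
      ¬ closedUnder (q.1 : Set α) (progReduct (q.2 : Set α) P)).toList.map
        fun q => excludeClause A φ p q.1 q.2

section Translation

variable {α : Type} [DecidableEq α] {P : List (AugClause α)} {A : Finset α} {φ : α → α} {p : α}

theorem isDisjunctive_of_mem_disjunctiveTranslation {c : FClause α}
    (hc : c ∈ disjunctiveTranslation P A φ p) : c.isDisjunctive := by
  simp only [disjunctiveTranslation, List.mem_append, List.mem_map] at hc
  rcases hc with ⟨a, -, rfl⟩ | ⟨q, -, rfl⟩
  · simp [FClause.isDisjunctive, FClause.isGeneral]
  · simp [FClause.isDisjunctive, FClause.isGeneral, excludeClause]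

theorem closedUnder_disjunctiveTranslation_iff {N M : Set α} :
    closedUnder N (progReduct M ((disjunctiveTranslation P A φ p).map FClause.toAug)) ↔
      (∀ a ∈ A, a ∉ M → φ a ∈ N) ∧
      ∀ X ⊆ A, ∀ Y ⊆ A, ¬ closedUnder (X : Set α) (progReduct (Y : Set α) P) →
        p ∉ M → (∀ a ∈ X, a ∈ N) → (∀ a ∈ A, a ∉ Y → a ∉ M) → (∀ a ∈ Y, φ a ∉ M) →
        p ∈ N ∨ ∃ a ∈ Y, a ∉ X ∧ a ∈ N := by
  rw [closedUnder_progReduct_toAug, disjunctiveTranslation, List.forall_mem_append,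
    List.forall_mem_map, List.forall_mem_map]
  refine and_congr ?_ ?_
  · simp [litHolds]
  · simp only [excludeClause, List.forall_mem_cons, List.exists_mem_cons_iff,
      List.forall_mem_append, List.forall_mem_map, exists_mem_listMap, litHolds,
      Finset.mem_toList, Finset.mem_filter, Finset.mem_product, Finset.mem_powerset,
      Finset.mem_sdiff, Prod.forall, and_imp, and_assoc]
    exact ⟨fun h X hX Y => h X Y hX, fun h X Y hX => h X hX Y⟩

/-- As long as `p` is false and each `φ a` is the complement of `a`, the translation says
the same as the original program. -/
theorem closedUnder_disjunctiveTranslation {N M : Set α} (hA : progSig P = A) (hNM : N ⊆ M)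
    (hp : p ∉ M) (hφ : ∀ a ∈ A, φ a ∈ M ↔ a ∉ M) :
    closedUnder N (progReduct M ((disjunctiveTranslation P A φ p).map FClause.toAug)) ↔
      (∀ a ∈ A, a ∉ M → φ a ∈ N) ∧ closedUnder N (progReduct M P) := by
  classical
  rw [closedUnder_disjunctiveTranslation_iff]
  refine and_congr_right fun _ => ⟨fun h => ?_, fun h X hX Y hY hXY _ hXN hAY hYφ => ?_⟩
  · by_contra hc
    have := h (A.filter (· ∈ N)) (Finset.filter_subset _ _) (A.filter (· ∈ M))
      (Finset.filter_subset _ _)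
      (fun h' => hc ((closedUnder_progReduct_congr hA.subset
        (fun a ha => by simp [Finset.mem_coe.1 ha])
        (fun a ha => by simp [Finset.mem_coe.1 ha])).1 h'))
      hp (by simp) (fun a ha h haM => h (by simp [ha, haM])) (by simp +contextual [hφ])
    rcases this with h' | ⟨a, ha, ha', haN⟩
    · exact hp (hNM h')
    · exact ha' (Finset.mem_filter.2 ⟨(Finset.mem_filter.1 ha).1, haN⟩)
  · by_contra! hc
    have hY' : ∀ a ∈ (A : Set α), a ∈ M ↔ a ∈ (Y : Set α) := fun a ha =>
      ⟨fun haM => by_contra fun haY => hAY a ha haY haM, fun haY =>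
        by_contra fun haM => hYφ a haY ((hφ a ha).2 haM)⟩
    have hX' : ∀ a ∈ (A : Set α), a ∈ N ↔ a ∈ (X : Set α) := fun a ha =>
      ⟨fun haN => by_contra fun haX => hc.2 a ((hY' a ha).1 (hNM haN)) haX haN, fun haX => hXN a haX⟩
    exact hXY ((closedUnder_progReduct_congr hA.subset hY' hX').1 h)

variable {U : Set α} {Q : List (AugClause α)}

theorem isAnswerSet.auxiliary_atoms {M : Set α} (hAU : (A : Set α) ⊆ U) (hQ : progSig Q ⊆ U)
    (hp : p ∉ U) (hφU : ∀ a ∈ A, φ a ∉ U) (hφp : ∀ a ∈ A, φ a ≠ p) (hinj : Set.InjOn φ A)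
    (h : isAnswerSet ((disjunctiveTranslation P A φ p).map FClause.toAug ++ Q) M) :
    p ∉ M ∧ ∀ a ∈ A, φ a ∈ M ↔ a ∉ M := by
  obtain ⟨hcl, hmin⟩ := h
  rw [closedUnder_progReduct_append, closedUnder_disjunctiveTranslation_iff] at hcl
  obtain ⟨⟨hcl, hex⟩, hclQ⟩ := hcl
  have hremove : ∀ x, x ∉ U →
      closedUnder (M \ {x}) (progReduct M ((disjunctiveTranslation P A φ p).map FClause.toAug)) →
      x ∉ M := by
    intro x hx hcl' hxM
    have := hmin (M \ {x}) Set.sdiff_subset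
      ((closedUnder_progReduct_append _ _ _ _).2 ⟨hcl', (closedUnder_progReduct_congr hQ
        (fun _ _ => Iff.rfl) (fun a ha => by
          have : a ≠ x := fun e => hx (e ▸ ha)
          simp [this])).1 hclQ⟩)
    rw [← this] at hxM
    exact hxM.2 rfl
  have hpM : p ∉ M := by
    intro hpM
    refine hremove p hp ?_ hpM
    rw [closedUnder_disjunctiveTranslation_iff]
    exact ⟨fun a ha haM => ⟨hcl a ha haM, hφp a ha⟩,
      fun X hX Y hY _ hpM' => absurd hpM hpM'⟩
  refine ⟨hpM, fun a ha => ⟨fun hφM haM => ?_, hcl a ha⟩⟩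
  refine hremove (φ a) (hφU a ha) ?_ hφM
  rw [closedUnder_disjunctiveTranslation_iff]
  refine ⟨fun b hb hbM => ⟨hcl b hb hbM, fun e => hbM ?_⟩,
    fun X hX Y hY hXY hpM hXN hAY hYφ => ?_⟩
  · rwa [hinj hb ha e]
  · rcases hex X hX Y hY hXY hpM (fun b hb => (hXN b hb).1) hAY hYφ with h' | ⟨b, hb, hbX, hbM⟩
    · exact absurd h' hpM
    · exact Or.inr ⟨b, hb, hbX, hbM, fun e => hφU a ha (e ▸ hAU (hY hb))⟩

theorem isAnswerSet.inter_progSig_of_disjunctiveTranslation {M : Set α} (hA : progSig P = A)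
    (hAU : (A : Set α) ⊆ U) (hQ : progSig Q ⊆ U)
    (hp : p ∉ U) (hφU : ∀ a ∈ A, φ a ∉ U) (hφp : ∀ a ∈ A, φ a ≠ p) (hinj : Set.InjOn φ A)
    (h : isAnswerSet ((disjunctiveTranslation P A φ p).map FClause.toAug ++ Q) M) :
    isAnswerSet (P ++ Q) (M ∩ progSig (P ++ Q)) := by
  obtain ⟨hpM, hφ⟩ := h.auxiliary_atoms hAU hQ hp hφU hφp hinj
  obtain ⟨hcl, hmin⟩ := h
  rw [closedUnder_progReduct_append, closedUnder_disjunctiveTranslation hA le_rfl hpM hφ] at hcl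
  set S := progSig (P ++ Q) with hS
  have hSU : S ⊆ U := by
    rw [hS, progSig_append, hA]
    exact Set.union_subset hAU hQ
  have hQS : progSig Q ⊆ S := by
    rw [hS, progSig_append]
    exact Set.subset_union_right
  have hMS : ∀ a ∈ S, a ∈ M ↔ a ∈ M ∩ S := fun a ha => by simp [ha]
  refine ⟨(closedUnder_progReduct_congr le_rfl hMS hMS).1
    ((closedUnder_progReduct_append _ _ _ _).2 ⟨hcl.1.2, hcl.2⟩), fun N hN hclN => ?_⟩
  have hNS : ∀ a ∈ S, a ∈ N ∪ (M \ S) ↔ a ∈ N := fun a ha => by simp [ha]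
  have hsub : N ∪ (M \ S) ⊆ M :=
    Set.union_subset (hN.trans Set.inter_subset_left) Set.sdiff_subset
  have hclN' := (closedUnder_progReduct_congr le_rfl hMS hNS).2 hclN
  rw [closedUnder_progReduct_append] at hclN'
  have heq : N ∪ (M \ S) = M := hmin _ hsub <| by
    rw [closedUnder_progReduct_append, closedUnder_disjunctiveTranslation hA hsub hpM hφ]
    exact ⟨⟨fun a ha haM => Or.inr ⟨(hφ a ha).2 haM, fun h' => hφU a ha (hSU h')⟩, hclN'.1⟩,
      hclN'.2⟩
  refine hN.antisymm fun a ha => ?_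
  rw [← hNS a ha.2, heq]
  exact ha.1

theorem isAnswerSet.disjunctiveTranslation_union {M : Set α} (hA : progSig P = A)
    (hAU : (A : Set α) ⊆ U) (hQ : progSig Q ⊆ U)
    (hp : p ∉ U) (hφU : ∀ a ∈ A, φ a ∉ U) (hφp : ∀ a ∈ A, φ a ≠ p) (hinj : Set.InjOn φ A)
    (h : isAnswerSet (P ++ Q) M) :
    isAnswerSet ((disjunctiveTranslation P A φ p).map FClause.toAug ++ Q)
      (M ∪ φ '' {a | a ∈ A ∧ a ∉ M}) := by
  have hMS := h.subset_progSig
  obtain ⟨hcl, hmin⟩ := h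
  set S := progSig (P ++ Q) with hS
  have hSU : S ⊆ U := by
    rw [hS, progSig_append, hA]
    exact Set.union_subset hAU hQ
  set M' := M ∪ φ '' {a | a ∈ A ∧ a ∉ M} with hM'
  have hMU : ∀ a ∈ U, a ∈ M' ↔ a ∈ M := by
    refine fun a ha => ⟨?_, Or.inl⟩
    rintro (haM | ⟨b, hb, rfl⟩)
    · exact haM
    · exact absurd ha (hφU b hb.1)
  have hpM : p ∉ M' := by
    rintro (hpM | ⟨b, hb, e⟩)
    · exact hp (hSU (hMS hpM))
    · exact hφp b hb.1 e
  have hφ : ∀ a ∈ A, φ a ∈ M' ↔ a ∉ M' := by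
    intro a ha
    rw [hMU a (hAU ha)]
    refine ⟨?_, fun haM => Or.inr ⟨a, ⟨ha, haM⟩, rfl⟩⟩
    rintro (haM | ⟨b, hb, e⟩)
    · exact absurd (hSU (hMS haM)) (hφU a ha)
    · exact hinj hb.1 ha e ▸ hb.2
  have hMS' : ∀ a ∈ S, a ∈ M' ↔ a ∈ M := fun a ha => hMU a (hSU ha)
  refine ⟨?_, fun N hN hclN => ?_⟩
  · have := (closedUnder_progReduct_congr le_rfl hMS' hMS').2 hcl
    rw [closedUnder_progReduct_append] at this ⊢
    rw [closedUnder_disjunctiveTranslation hA le_rfl hpM hφ]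
    exact ⟨⟨fun a ha => (hφ a ha).2, this.1⟩, this.2⟩
  · rw [closedUnder_progReduct_append, closedUnder_disjunctiveTranslation hA hN hpM hφ,
      and_assoc, ← closedUnder_progReduct_append] at hclN
    have heq : N ∩ S = M := hmin _ (fun a ha => (hMS' a ha.2).1 (hN ha.1))
      ((closedUnder_progReduct_congr le_rfl hMS' fun a ha => (and_iff_left ha).symm).1 hclN.2)
    refine hN.antisymm ?_
    rintro a (haM | ⟨b, hb, rfl⟩)
    · rw [← heq] at haM
      exact haM.1
    · exact hclN.1 b hb.1 fun hbM => hb.2 ((hMU b (hAU hb.1)).1 hbM)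

end Translation

/-- for every augmented user program `P` there is a disjunctive
program `P'` which is a strong conservative extension of `P`.  `U` is the user
signature; the reserved atoms `Uᶜ` form an unbounded supply of fresh atoms. -/
theorem augmented_has_disjunctive_strong_conservative_extension {α : Type}
    [DecidableEq α] (U : Set α) (hR : (Uᶜ : Set α).Infinite)
    (P : List (AugClause α)) (hP : progSig P ⊆ U) :
    ∃ P' : List (FClause α), (∀ c ∈ P', c.isDisjunctive) ∧
      strongConsExt P (P'.map FClause.toAug) U := by
  obtain ⟨A, hA⟩ := (finite_progSig P).exists_finset_coe
  have hAU : (A : Set α) ⊆ U := hA ▸ hP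
  obtain ⟨p, hp⟩ := hR.nonempty
  have hfresh : ((Uᶜ : Set α) \ {p}).Infinite := hR.sdiff (Set.finite_singleton p)
  have : Nonempty α := ⟨p⟩
  obtain ⟨φ, hφ, hinj⟩ := A.finite_toSet.exists_injOn_of_encard_le
    (t := (Uᶜ : Set α) \ {p}) (by rw [hfresh.encard_eq]; exact le_top)
  have hφU : ∀ a ∈ A, φ a ∉ U := fun a ha => (hφ ha).1
  have hφp : ∀ a ∈ A, φ a ≠ p := fun a ha => (hφ ha).2
  refine ⟨disjunctiveTranslation P A φ p,
    fun c hc => isDisjunctive_of_mem_disjunctiveTranslation hc, fun Q hQ => ⟨fun M hM =>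
      hM.inter_progSig_of_disjunctiveTranslation hA.symm hAU hQ hp hφU hφp hinj, fun M hM =>
      ⟨_, hM.disjunctiveTranslation_union hA.symm hAU hQ hp hφU hφp hinj, ?_⟩⟩⟩
  have hSU : progSig (P ++ Q) ⊆ U := by
    rw [progSig_append]
    exact Set.union_subset hP hQ
  ext a
  constructor
  · exact fun ha => ⟨Or.inl ha, hM.subset_progSig ha⟩
  · rintro ⟨haM | ⟨b, hb, rfl⟩, haS⟩
    · exact haM
    · exact absurd (hSU haS) (hφU b hb.1)

end ASP
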